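/- Let θ be a real antisymmetric 4 × 4 matrix. The twisted tensor product Δ₊^{(⋆2)} is a well-defined tempered distribution on ℝ⁸: for every Schwartz function g on ℝ⁴ × ℝ⁴, all integrals in Δ₊^{(⋆2)}(g) := (2π)^{−6} ∫_{ℝ³×ℝ³} (e^{−i⟨p̃, θ k̃⟩}/(4ω(k)ω(p))) · ( ∫_{ℝ⁸} g(x, y) e^{−i(ω(k) x₀ + ω(p) y₀) + i(⟨k, x⃗⟩ + ⟨p, y⃗⟩)} dx dy ) dk dp converge absolutely, where k̃ = (ω(k), k) and p̃ = (ω(p), p), and the map g ↦ Δ₊^{(⋆2)}(g) is a continuous linear functional on the Schwartz space 𝒮(ℝ⁸, ℂ). -/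

import Mathlib

open MeasureTheory

/-- The on-shell energy `ω(k) = √(|k|² + m²)` for `k ∈ ℝ³`. -/
noncomputable def omega (m : ℝ) (k : Fin 3 → ℝ) : ℝ :=
  Real.sqrt ((∑ i, k i ^ 2) + m ^ 2)

/-- The on-shell four-momentum `k̃ = (ω(k), k) ∈ ℝ⁴`. -/
noncomputable def onShell (m : ℝ) (k : Fin 3 → ℝ) : Fin 4 → ℝ :=
  ![omega m k, k 0, k 1, k 2]

/-- The on-shell twisting pairing `⟨p̃, θ k̃⟩ = p̃ · (θ k̃)`. -/
noncomputable def twist (m : ℝ) (θ : Matrix (Fin 4) (Fin 4) ℝ) (k p : Fin 3 → ℝ) : ℝ :=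
  ∑ i : Fin 4, onShell m p i * ∑ j : Fin 4, θ i j * onShell m k j

/-- The twisted tensor product `Δ₊^{(⋆2)}` of two-point functions, as a functional on
functions on `ℝ⁸ = ℝ⁴ × ℝ⁴`. -/
noncomputable def twoPointTw (m : ℝ) (θ : Matrix (Fin 4) (Fin 4) ℝ)
    (g : ((ℝ × (Fin 3 → ℝ)) × (ℝ × (Fin 3 → ℝ))) → ℂ) : ℂ :=
  ((((2 * Real.pi) ^ 6)⁻¹ : ℝ) : ℂ) *
    ∫ kp : (Fin 3 → ℝ) × (Fin 3 → ℝ),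
      Complex.exp (-Complex.I * ((twist m θ kp.1 kp.2 : ℝ) : ℂ)) *
        (((4 * omega m kp.1 * omega m kp.2)⁻¹ : ℝ) : ℂ) *
        ∫ xy : (ℝ × (Fin 3 → ℝ)) × (ℝ × (Fin 3 → ℝ)),
          g xy * Complex.exp
            (-Complex.I * ((omega m kp.1 : ℂ) * (xy.1.1 : ℂ) + (omega m kp.2 : ℂ) * (xy.2.1 : ℂ)) +
              Complex.I * ((∑ i, (kp.1 i : ℂ) * (xy.1.2 i : ℂ)) +
                ∑ i, (kp.2 i : ℂ) * (xy.2.2 i : ℂ)))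

/-- A Schwartz function pulled back along a continuous map that does not shrink norms by more than a
constant factor, multiplied by a bounded weight, is integrable, and its integral is a tempered
distribution. -/
theorem SchwartzMap.exists_clm_integral_comp {V X : Type*} [NormedAddCommGroup V]
    [NormedSpace ℝ V] [NormedAddCommGroup X] [NormedSpace ℝ X] [FiniteDimensional ℝ X]
    [MeasurableSpace X] [BorelSpace X] (μ : Measure X) [μ.IsAddHaarMeasure]
    {w : X → ℂ} (hw : AEStronglyMeasurable w μ) {C : ℝ} (hC : ∀ x, ‖w x‖ ≤ C)
    {ξ : X → V} (hξ : Continuous ξ) {D : ℝ} (hD : ∀ x, ‖x‖ ≤ D * ‖ξ x‖) :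
    ∃ u : SchwartzMap V ℂ →L[ℂ] ℂ, ∀ f : SchwartzMap V ℂ,
      Integrable (fun x => w x * f (ξ x)) μ ∧ u f = ∫ x, w x * f (ξ x) ∂μ := by
  set n : ℕ := Module.finrank ℝ X + 1
  have hC0 : 0 ≤ C := (norm_nonneg _).trans (hC 0)
  set K : ℝ := 1 + |D|
  have hK : 1 ≤ K := le_add_of_nonneg_right (abs_nonneg D)
  let N : Seminorm ℂ (SchwartzMap V ℂ) :=
    (Finset.Iic (n, 0)).sup (schwartzSeminormFamily ℂ V ℂ)
  have hint : Integrable (fun x : X => (1 + ‖x‖) ^ (-(n : ℝ))) μ :=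
    integrable_one_add_norm (by simp [n])
  have hbound (f : SchwartzMap V ℂ) (x : X) :
      ‖w x * f (ξ x)‖ ≤ C * K ^ n * 2 ^ n * N f * (1 + ‖x‖) ^ (-(n : ℝ)) := by
    have h₁ : (1 + ‖ξ x‖) ^ n * ‖f (ξ x)‖ ≤ 2 ^ n * N f := by
      rw [← norm_iteratedFDeriv_zero (𝕜 := ℝ) (f := f)]
      exact SchwartzMap.one_add_le_sup_seminorm_apply (m := (n, 0)) le_rfl le_rfl f (ξ x)
    have h₂ : 1 + ‖x‖ ≤ K * (1 + ‖ξ x‖) := by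
      have : D * ‖ξ x‖ ≤ |D| * ‖ξ x‖ := by gcongr; exact le_abs_self D
      have := hD x
      have := norm_nonneg (ξ x)
      have := abs_nonneg D
      simp only [K]
      nlinarith
    rw [Real.rpow_neg (by positivity), Real.rpow_natCast, ← div_eq_mul_inv,
      le_div_iff₀ (by positivity), norm_mul]
    calc ‖w x‖ * ‖f (ξ x)‖ * (1 + ‖x‖) ^ n
        ≤ C * ‖f (ξ x)‖ * (K * (1 + ‖ξ x‖)) ^ n := by gcongr; exact hC x
      _ = C * K ^ n * ((1 + ‖ξ x‖) ^ n * ‖f (ξ x)‖) := by rw [mul_pow]; ring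
      _ ≤ C * K ^ n * (2 ^ n * N f) := by gcongr
      _ = C * K ^ n * 2 ^ n * N f := by ring
  have hintf (f : SchwartzMap V ℂ) : Integrable (fun x => w x * f (ξ x)) μ :=
    (hint.const_mul _).mono' (hw.mul (f.continuous.comp hξ).aestronglyMeasurable)
      (.of_forall (hbound f))
  refine ⟨SchwartzMap.mkCLMtoNormedSpace (σ := RingHom.id ℂ) (fun f => ∫ x, w x * f (ξ x) ∂μ)
    (fun f g => ?_) (fun a f => ?_) ⟨Finset.Iic (n, 0),
      C * K ^ n * 2 ^ n * ∫ x, (1 + ‖x‖) ^ (-(n : ℝ)) ∂μ, ?_, fun f => ?_⟩,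
    fun f => ⟨hintf f, rfl⟩⟩
  · rw [← integral_add (hintf f) (hintf g)]
    simp [mul_add]
  · rw [RingHom.id_apply, smul_eq_mul, ← integral_const_mul]
    simp [mul_left_comm]
  · have : 0 ≤ ∫ x, (1 + ‖x‖) ^ (-(n : ℝ)) ∂μ := integral_nonneg fun x => by positivity
    positivity
  · calc ‖∫ x, w x * f (ξ x) ∂μ‖
        ≤ ∫ x, C * K ^ n * 2 ^ n * N f * (1 + ‖x‖) ^ (-(n : ℝ)) ∂μ :=
          norm_integral_le_of_norm_le (hint.const_mul _) (.of_forall (hbound f))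
      _ = C * K ^ n * 2 ^ n * (∫ x, (1 + ‖x‖) ^ (-(n : ℝ)) ∂μ) * N f := by
          rw [integral_const_mul]; ring

/-- Four-dimensional spacetime with its Euclidean inner product. -/
abbrev EuclideanSpacetime : Type := WithLp 2 (ℝ × EuclideanSpace ℝ (Fin 3))

/-- Forgetting the Euclidean norm on spacetime. -/
noncomputable def spacetimeEquiv : EuclideanSpacetime ≃L[ℝ] ℝ × (Fin 3 → ℝ) :=
  (WithLp.prodContinuousLinearEquiv 2 ℝ ℝ (EuclideanSpace ℝ (Fin 3))).trans
    ((ContinuousLinearEquiv.refl ℝ ℝ).prodCongr (EuclideanSpace.equiv (Fin 3) ℝ))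

/-- Forgetting the Euclidean norm on pairs of spacetime points. -/
noncomputable def spacetimePairEquiv :
    WithLp 2 (EuclideanSpacetime × EuclideanSpacetime) ≃L[ℝ]
      (ℝ × (Fin 3 → ℝ)) × (ℝ × (Fin 3 → ℝ)) :=
  (WithLp.prodContinuousLinearEquiv 2 ℝ EuclideanSpacetime EuclideanSpacetime).trans
    (spacetimeEquiv.prodCongr spacetimeEquiv)

theorem measurePreserving_spacetimeEquiv : MeasurePreserving spacetimeEquiv :=
  ((MeasurePreserving.id volume).prod (PiLp.volume_preserving_ofLp (Fin 3))).comp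
    (WithLp.volume_preserving_ofLp ℝ (EuclideanSpace ℝ (Fin 3)))

theorem measurePreserving_spacetimePairEquiv : MeasurePreserving spacetimePairEquiv :=
  (measurePreserving_spacetimeEquiv.prod measurePreserving_spacetimeEquiv).comp
    (WithLp.volume_preserving_ofLp EuclideanSpacetime EuclideanSpacetime)

theorem inner_spacetimeEquiv_symm (v : EuclideanSpacetime) (q : ℝ × (Fin 3 → ℝ)) :
    inner ℝ v (spacetimeEquiv.symm q) =
      (spacetimeEquiv v).1 * q.1 + ∑ i, (spacetimeEquiv v).2 i * q.2 i := by
  simp [spacetimeEquiv, WithLp.prod_inner_apply, PiLp.inner_apply, mul_comm]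

theorem inner_spacetimePairEquiv_symm (v : WithLp 2 (EuclideanSpacetime × EuclideanSpacetime))
    (q : (ℝ × (Fin 3 → ℝ)) × (ℝ × (Fin 3 → ℝ))) :
    inner ℝ v (spacetimePairEquiv.symm q) =
      ((spacetimePairEquiv v).1.1 * q.1.1 + ∑ i, (spacetimePairEquiv v).1.2 i * q.1.2 i) +
      ((spacetimePairEquiv v).2.1 * q.2.1 + ∑ i, (spacetimePairEquiv v).2.2 i * q.2.2 i) := by
  rw [WithLp.prod_inner_apply]
  exact congrArg₂ _ (inner_spacetimeEquiv_symm v.fst q.1) (inner_spacetimeEquiv_symm v.snd q.2)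

instance isAddHaarMeasure_volume_momentumPair :
    (volume : Measure ((Fin 3 → ℝ) × (Fin 3 → ℝ))).IsAddHaarMeasure :=
  Measure.prod.instIsAddHaarMeasure volume volume

instance isAddHaarMeasure_volume_spacetimePair :
    (volume : Measure ((ℝ × (Fin 3 → ℝ)) × (ℝ × (Fin 3 → ℝ)))).IsAddHaarMeasure :=
  have : (volume : Measure (ℝ × (Fin 3 → ℝ))).IsAddHaarMeasure :=
    Measure.prod.instIsAddHaarMeasure volume volume
  Measure.prod.instIsAddHaarMeasure volume volume

theorem continuous_omega (m : ℝ) : Continuous (omega m) := by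
  unfold omega
  fun_prop

theorem le_omega (m : ℝ) (k : Fin 3 → ℝ) : m ≤ omega m k :=
  Real.le_sqrt_of_sq_le (le_add_of_nonneg_left (Finset.sum_nonneg fun _ _ => sq_nonneg _))

theorem continuous_twist (m : ℝ) (θ : Matrix (Fin 4) (Fin 4) ℝ) :
    Continuous fun kp : (Fin 3 → ℝ) × (Fin 3 → ℝ) => twist m θ kp.1 kp.2 := by
  have := continuous_omega m
  have h (i : Fin 4) : Continuous fun k => onShell m k i := by
    fin_cases i <;> simp [onShell] <;> fun_prop
  unfold twist
  exact continuous_finsetSum _ fun i _ => ((h i).comp continuous_snd).mul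
    (continuous_finsetSum _ fun j _ => ((h j).comp continuous_fst).const_mul _)

/-- The frequency at which the Fourier transform is evaluated in the two-point functional. -/
noncomputable def shellFreq (m : ℝ) (k : Fin 3 → ℝ) : ℝ × (Fin 3 → ℝ) :=
  (2 * Real.pi)⁻¹ • (omega m k, -k)

theorem continuous_shellFreq (m : ℝ) : Continuous (shellFreq m) := by
  have := continuous_omega m
  unfold shellFreq
  fun_prop

theorem norm_le_norm_shellFreq (m : ℝ) (k : Fin 3 → ℝ) :
    ‖k‖ ≤ 2 * Real.pi * ‖shellFreq m k‖ := by
  have h2 : (0 : ℝ) < 2 * Real.pi := by positivity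
  rw [shellFreq, norm_smul, norm_inv, Real.norm_of_nonneg h2.le, mul_inv_cancel_left₀ h2.ne']
  exact (norm_neg k).symm.le.trans (norm_snd_le (omega m k, -k))

/-- The on-shell frequencies of a pair of momenta, as a Euclidean vector. -/
noncomputable def shellFreqPair (m : ℝ) (kp : (Fin 3 → ℝ) × (Fin 3 → ℝ)) :
    WithLp 2 (EuclideanSpacetime × EuclideanSpacetime) :=
  spacetimePairEquiv.symm (shellFreq m kp.1, shellFreq m kp.2)

theorem continuous_shellFreqPair (m : ℝ) : Continuous (shellFreqPair m) :=
  spacetimePairEquiv.symm.continuous.comp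
    (((continuous_shellFreq m).comp continuous_fst).prodMk
      ((continuous_shellFreq m).comp continuous_snd))

theorem norm_le_norm_shellFreqPair (m : ℝ) (kp : (Fin 3 → ℝ) × (Fin 3 → ℝ)) :
    ‖kp‖ ≤ 2 * Real.pi * ‖spacetimePairEquiv.toContinuousLinearMap‖ * ‖shellFreqPair m kp‖ := by
  have h2 : (0 : ℝ) ≤ 2 * Real.pi := by positivity
  calc ‖kp‖ ≤ 2 * Real.pi * ‖(shellFreq m kp.1, shellFreq m kp.2)‖ :=
        max_le
          ((norm_le_norm_shellFreq m kp.1).trans (mul_le_mul_of_nonneg_left (norm_fst_le (_, _)) h2))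
          ((norm_le_norm_shellFreq m kp.2).trans (mul_le_mul_of_nonneg_left (norm_snd_le (_, _)) h2))
    _ ≤ 2 * Real.pi * (‖spacetimePairEquiv.toContinuousLinearMap‖ * ‖shellFreqPair m kp‖) := by
        gcongr
        simpa [shellFreqPair] using
          spacetimePairEquiv.toContinuousLinearMap.le_opNorm (shellFreqPair m kp)
    _ = _ := by ring

open FourierTransform in
theorem fourier_shellFreqPair (m : ℝ) (g : (ℝ × (Fin 3 → ℝ)) × (ℝ × (Fin 3 → ℝ)) → ℂ)
    (kp : (Fin 3 → ℝ) × (Fin 3 → ℝ)) :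
    𝓕 (g ∘ spacetimePairEquiv) (shellFreqPair m kp) =
      ∫ xy : (ℝ × (Fin 3 → ℝ)) × (ℝ × (Fin 3 → ℝ)),
        g xy * Complex.exp
          (-Complex.I * ((omega m kp.1 : ℂ) * (xy.1.1 : ℂ) + (omega m kp.2 : ℂ) * (xy.2.1 : ℂ)) +
            Complex.I * ((∑ i, (kp.1 i : ℂ) * (xy.1.2 i : ℂ)) +
              ∑ i, (kp.2 i : ℂ) * (xy.2.2 i : ℂ))) := by
  rw [Real.fourier_eq', ← measurePreserving_spacetimePairEquiv.integral_comp
    spacetimePairEquiv.toHomeomorph.measurableEmbedding]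
  refine integral_congr_ae (.of_forall fun v => ?_)
  simp only [Function.comp_apply, smul_eq_mul]
  rw [mul_comm]
  congr 2
  rw [shellFreqPair, inner_spacetimePairEquiv_symm]
  have hpi : (Real.pi : ℂ) ≠ 0 := by exact_mod_cast Real.pi_ne_zero
  simp only [shellFreq, Fin.sum_univ_three, Prod.smul_fst, Prod.smul_snd, Pi.smul_apply,
    Pi.neg_apply, smul_eq_mul]
  push_cast
  field_simp
  ring

theorem integrable_mul_onShell_phase (m : ℝ)
    (g : SchwartzMap ((ℝ × (Fin 3 → ℝ)) × (ℝ × (Fin 3 → ℝ))) ℂ)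
    (kp : (Fin 3 → ℝ) × (Fin 3 → ℝ)) :
    Integrable (fun xy : (ℝ × (Fin 3 → ℝ)) × (ℝ × (Fin 3 → ℝ)) =>
      g xy * Complex.exp
        (-Complex.I * ((omega m kp.1 : ℂ) * (xy.1.1 : ℂ) + (omega m kp.2 : ℂ) * (xy.2.1 : ℂ)) +
          Complex.I * ((∑ i, (kp.1 i : ℂ) * (xy.1.2 i : ℂ)) +
            ∑ i, (kp.2 i : ℂ) * (xy.2.2 i : ℂ)))) := by
  refine g.integrable.mul_bdd (c := 1) (Continuous.aestronglyMeasurable (by fun_prop))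
    (.of_forall fun xy => ?_)
  rw [Complex.norm_exp]
  simp

theorem norm_twist_weight_le {m : ℝ} (hm : 0 < m) (θ : Matrix (Fin 4) (Fin 4) ℝ)
    (k p : Fin 3 → ℝ) :
    ‖Complex.exp (-Complex.I * ((twist m θ k p : ℝ) : ℂ)) *
      (((4 * omega m k * omega m p)⁻¹ : ℝ) : ℂ)‖ ≤ (4 * m * m)⁻¹ := by
  have hk := le_omega m k
  have hp := le_omega m p
  have h : 0 < 4 * omega m k * omega m p := by
    have := hm.trans_le hk
    have := hm.trans_le hp
    positivity
  rw [norm_mul, Complex.norm_exp, Complex.norm_real, Real.norm_of_nonneg (by positivity)]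
  simp only [neg_mul, Complex.neg_re, Complex.I_mul_re, Complex.ofReal_im, neg_zero, Real.exp_zero,
    one_mul]
  have := hm.trans_le hk
  gcongr

theorem continuous_twist_weight {m : ℝ} (hm : 0 < m) (θ : Matrix (Fin 4) (Fin 4) ℝ) :
    Continuous fun kp : (Fin 3 → ℝ) × (Fin 3 → ℝ) =>
      Complex.exp (-Complex.I * ((twist m θ kp.1 kp.2 : ℝ) : ℂ)) *
        (((4 * omega m kp.1 * omega m kp.2)⁻¹ : ℝ) : ℂ) := by
  have hω := continuous_omega m
  have hθ := continuous_twist m θ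
  have hne (kp : (Fin 3 → ℝ) × (Fin 3 → ℝ)) : 4 * omega m kp.1 * omega m kp.2 ≠ 0 := by
    have := hm.trans_le (le_omega m kp.1)
    have := hm.trans_le (le_omega m kp.2)
    positivity
  have hinv : Continuous fun kp : (Fin 3 → ℝ) × (Fin 3 → ℝ) =>
      (4 * omega m kp.1 * omega m kp.2)⁻¹ := by
    refine Continuous.inv₀ ?_ hne
    fun_prop
  fun_prop

/-- The twisted tensor product `Δ₊^{(⋆2)}` is a well-defined tempered distribution on
`ℝ⁸`: for every Schwartz `g` all integrals converge absolutely, and `g ↦ Δ₊^{(⋆2)}(g)`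
is a continuous linear functional on Schwartz space. -/
theorem twoPointTw_tempered (m : ℝ) (hm : 0 < m)
    (θ : Matrix (Fin 4) (Fin 4) ℝ) (hθ : θ.transpose = -θ) :
    (∀ g : SchwartzMap ((ℝ × (Fin 3 → ℝ)) × (ℝ × (Fin 3 → ℝ))) ℂ,
      ∀ kp : (Fin 3 → ℝ) × (Fin 3 → ℝ),
      Integrable (fun xy : (ℝ × (Fin 3 → ℝ)) × (ℝ × (Fin 3 → ℝ)) =>
        g xy * Complex.exp
          (-Complex.I * ((omega m kp.1 : ℂ) * (xy.1.1 : ℂ) + (omega m kp.2 : ℂ) * (xy.2.1 : ℂ)) +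
            Complex.I * ((∑ i, (kp.1 i : ℂ) * (xy.1.2 i : ℂ)) +
              ∑ i, (kp.2 i : ℂ) * (xy.2.2 i : ℂ))))) ∧
    (∀ g : SchwartzMap ((ℝ × (Fin 3 → ℝ)) × (ℝ × (Fin 3 → ℝ))) ℂ,
      Integrable (fun kp : (Fin 3 → ℝ) × (Fin 3 → ℝ) =>
        Complex.exp (-Complex.I * ((twist m θ kp.1 kp.2 : ℝ) : ℂ)) *
          (((4 * omega m kp.1 * omega m kp.2)⁻¹ : ℝ) : ℂ) *
          ∫ xy : (ℝ × (Fin 3 → ℝ)) × (ℝ × (Fin 3 → ℝ)),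
            g xy * Complex.exp
              (-Complex.I * ((omega m kp.1 : ℂ) * (xy.1.1 : ℂ) +
                  (omega m kp.2 : ℂ) * (xy.2.1 : ℂ)) +
                Complex.I * ((∑ i, (kp.1 i : ℂ) * (xy.1.2 i : ℂ)) +
                  ∑ i, (kp.2 i : ℂ) * (xy.2.2 i : ℂ))))) ∧
    ∃ u : SchwartzMap ((ℝ × (Fin 3 → ℝ)) × (ℝ × (Fin 3 → ℝ))) ℂ →L[ℂ] ℂ,
      ∀ g : SchwartzMap ((ℝ × (Fin 3 → ℝ)) × (ℝ × (Fin 3 → ℝ))) ℂ,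
        u g = twoPointTw m θ g := by
  obtain ⟨u, hu⟩ := SchwartzMap.exists_clm_integral_comp
    (volume : Measure ((Fin 3 → ℝ) × (Fin 3 → ℝ)))
    (continuous_twist_weight hm θ).aestronglyMeasurable
    (fun kp => norm_twist_weight_le hm θ kp.1 kp.2)
    (continuous_shellFreqPair m) (norm_le_norm_shellFreqPair m)
  let F : SchwartzMap ((ℝ × (Fin 3 → ℝ)) × (ℝ × (Fin 3 → ℝ))) ℂ →L[ℂ]
      SchwartzMap (WithLp 2 (EuclideanSpacetime × EuclideanSpacetime)) ℂ :=
    (FourierTransform.fourierCLM ℂ _).comp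
      (SchwartzMap.compCLMOfContinuousLinearEquiv ℂ spacetimePairEquiv)
  have hF (g : SchwartzMap ((ℝ × (Fin 3 → ℝ)) × (ℝ × (Fin 3 → ℝ))) ℂ)
      (kp : (Fin 3 → ℝ) × (Fin 3 → ℝ)) :=
    (show F g (shellFreqPair m kp) = _ from
      congrFun (SchwartzMap.fourier_coe _) _).trans (fourier_shellFreqPair m g kp)
  refine ⟨integrable_mul_onShell_phase m, fun g => ?_,
    ((((2 * Real.pi) ^ 6)⁻¹ : ℝ) : ℂ) • u.comp F, fun g => ?_⟩
  · simpa only [hF] using (hu (F g)).1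
  · simpa only [twoPointTw, hF, smul_eq_mul, _root_.smul_apply,
      ContinuousLinearMap.comp_apply] using
      congrArg (((((2 * Real.pi) ^ 6)⁻¹ : ℝ) : ℂ) * ·) (hu (F g)).2
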